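/- Let A be a bialgebra and M, N left-right Yetter-Drinfel'd modules over A, with face maps b_i^{n,p} and coface maps c_j^{n,p} on Y^{n,p}(M,N) = Hom(A^n⊗M, N⊗A^p) as in the Yetter-Drinfel'd bicomplex. Then for all 0 ≤ i ≤ n+1 and 0 ≤ j ≤ p+1, one has c_j^{n+1,p} ∘ b_i^{n,p} = b_i^{n,p+1} ∘ c_j^{n,p}; in particular the differentials d_m = Σ(-1)^i b_i and d_c = Σ(-1)^j c_j commute: d_c^{n+1,p} ∘ d_m^{n,p} = d_m^{n,p+1} ∘ d_c^{n,p}, so (Y^{n,p}(M,N), d_m, d_c) is a double complex. -/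

import Mathlib

open TensorProduct
noncomputable section

namespace PS

variable (k : Type) [Field k] (A : Type) [Ring A] [Bialgebra k A]

/-- Left-nested tensor powers with base `B`: `pwr B n = B ⊗ A ⊗ ⋯ ⊗ A` (`n` copies of `A`). -/
def pwr (B : ModuleCat k) : ℕ → ModuleCat k
  | 0 => B
  | n + 1 => ModuleCat.of k (pwr B n ⊗[k] A)

/-- `A^{⊗ n}` realized as `pwr k n`, i.e. `k ⊗ A ⊗ ⋯ ⊗ A`. -/
abbrev Pk (n : ℕ) : ModuleCat k := pwr k A (ModuleCat.of k k) n

abbrev μA : A ⊗[k] A →ₗ[k] A := LinearMap.mul' k A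
abbrev ΔA : A →ₗ[k] A ⊗[k] A := Coalgebra.comul
abbrev εA : A →ₗ[k] k := Coalgebra.counit

/-- Multiplication of the tensorands in slots `i` and `i+1` (`1 ≤ i ≤ n`);
junk (zero map) for other `i`. -/
def mulP : (n : ℕ) → (i : ℕ) → ((Pk k A (n+1) : Type) →ₗ[k] Pk k A n)
  | 0, _ => 0
  | n + 1, i =>
      if i = n + 1 then
        (TensorProduct.map (LinearMap.id : (Pk k A n : Type) →ₗ[k] Pk k A n) (μA k A)).comp
          (TensorProduct.assoc k (Pk k A n) A A).toLinearMap
      else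
        TensorProduct.map (mulP n i) (LinearMap.id : A →ₗ[k] A)

/-- Insert an `A`-factor at the innermost slot (slot 1). -/
def insP : (n : ℕ) → (A ⊗[k] (Pk k A n : Type)) ≃ₗ[k] (Pk k A (n+1) : Type)
  | 0 => TensorProduct.comm k A k
  | n + 1 =>
      (TensorProduct.assoc k A (Pk k A n) A).symm.trans
        (TensorProduct.congr (insP n) (LinearEquiv.refl k A))

section NM

variable {N : Type} [AddCommGroup N] [Module k N]

/-- The left diagonal action of `A` on `N ⊗ A^{⊗ p}` built from a base action `ωN`. -/
def ldiag (ωN : A ⊗[k] N →ₗ[k] N) :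
    (p : ℕ) → (A ⊗[k] (pwr k A (ModuleCat.of k N) p : Type) →ₗ[k] pwr k A (ModuleCat.of k N) p)
  | 0 => ωN
  | p + 1 =>
      (TensorProduct.map (ldiag ωN p) (μA k A)).comp <|
        ((TensorProduct.tensorTensorTensorComm k A A
            (pwr k A (ModuleCat.of k N) p : Type) A).toLinearMap).comp
          (TensorProduct.map (ΔA k A) (LinearMap.id :
            ((pwr k A (ModuleCat.of k N) p : Type) ⊗[k] A) →ₗ[k] _))

/-- Right diagonal multiplication on the `A`-slots of `N ⊗ A^{⊗ p}` (counit on the base). -/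
def rdiagE : (p : ℕ) →
    ((pwr k A (ModuleCat.of k N) p : Type) ⊗[k] A →ₗ[k] pwr k A (ModuleCat.of k N) p)
  | 0 => (TensorProduct.rid k N).toLinearMap.comp
      (TensorProduct.map (LinearMap.id : N →ₗ[k] N) (εA k A))
  | p + 1 =>
      (TensorProduct.map (rdiagE p) (μA k A)).comp <|
        ((TensorProduct.tensorTensorTensorComm k
            (pwr k A (ModuleCat.of k N) p : Type) A A A).toLinearMap).comp
          (TensorProduct.map
            (LinearMap.id : ((pwr k A (ModuleCat.of k N) p : Type) ⊗[k] A) →ₗ[k] _) (ΔA k A))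

/-- Right diagonal action on `N ⊗ A^{⊗ p}` built from a base (right) action `ωNr`. -/
def rdiagAct (ωNr : N ⊗[k] A →ₗ[k] N) : (p : ℕ) →
    ((pwr k A (ModuleCat.of k N) p : Type) ⊗[k] A →ₗ[k] pwr k A (ModuleCat.of k N) p)
  | 0 => ωNr
  | p + 1 =>
      (TensorProduct.map (rdiagAct ωNr p) (μA k A)).comp <|
        ((TensorProduct.tensorTensorTensorComm k
            (pwr k A (ModuleCat.of k N) p : Type) A A A).toLinearMap).comp
          (TensorProduct.map
            (LinearMap.id : ((pwr k A (ModuleCat.of k N) p : Type) ⊗[k] A) →ₗ[k] _) (ΔA k A))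

end NM

/-- `dL : A^{⊗ n} → A ⊗ A^{⊗ n}`, `a^1 ⊗ ⋯ ⊗ a^n ↦ Σ (a^1)_1 ⋯ (a^n)_1 ⊗ ((a^1)_2 ⊗ ⋯ ⊗ (a^n)_2)`. -/
def dL : (n : ℕ) → ((Pk k A n : Type) →ₗ[k] A ⊗[k] (Pk k A n : Type))
  | 0 => (TensorProduct.map (Algebra.linearMap k A) (LinearMap.id : k →ₗ[k] k)).comp
      (TensorProduct.lid k k).symm.toLinearMap
  | n + 1 =>
      (TensorProduct.map (μA k A)
          (LinearMap.id : ((Pk k A n : Type) ⊗[k] A) →ₗ[k] _)).comp <|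
        ((TensorProduct.tensorTensorTensorComm k A (Pk k A n : Type) A A).toLinearMap).comp
          (TensorProduct.map (dL n) (ΔA k A))

/-- `dR : A^{⊗ n} → A^{⊗ n} ⊗ A`, `a^1 ⊗ ⋯ ⊗ a^n ↦ Σ ((a^1)_1 ⊗ ⋯ ⊗ (a^n)_1) ⊗ (a^1)_2 ⋯ (a^n)_2`. -/
def dR : (n : ℕ) → ((Pk k A n : Type) →ₗ[k] (Pk k A n : Type) ⊗[k] A)
  | 0 => (TensorProduct.map (LinearMap.id : k →ₗ[k] k) (Algebra.linearMap k A)).comp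
      (TensorProduct.rid k k).symm.toLinearMap
  | n + 1 =>
      (TensorProduct.map
          (LinearMap.id : ((Pk k A n : Type) ⊗[k] A) →ₗ[k] _) (μA k A)).comp <|
        ((TensorProduct.tensorTensorTensorComm k (Pk k A n : Type) A A A).toLinearMap).comp
          (TensorProduct.map (dR n) (ΔA k A))

section Base

variable {N : Type} [AddCommGroup N] [Module k N]

/-- Apply `ρN : N → N ⊗ A` to the base of `N ⊗ A^{⊗ p}`. -/
def rhoBase (ρN : N →ₗ[k] N ⊗[k] A) : (p : ℕ) →
    ((pwr k A (ModuleCat.of k N) p : Type) →ₗ[k] pwr k A (ModuleCat.of k (N ⊗[k] A)) p)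
  | 0 => ρN
  | p + 1 => TensorProduct.map (rhoBase ρN p) (LinearMap.id : A →ₗ[k] A)

/-- Reinterpret `(N ⊗ A) ⊗ A^{⊗ p}` as `N ⊗ A^{⊗ (p+1)}`. -/
def shiftB : (p : ℕ) →
    ((pwr k A (ModuleCat.of k (N ⊗[k] A)) p : Type) ≃ₗ[k] pwr k A (ModuleCat.of k N) (p+1))
  | 0 => LinearEquiv.refl k (N ⊗[k] A)
  | p + 1 => TensorProduct.congr (shiftB p) (LinearEquiv.refl k A)

/-- Multiply the `A`-component of the base `N ⊗ A` on the right by an element of `A`. -/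
def rmulBase : (p : ℕ) →
    ((pwr k A (ModuleCat.of k (N ⊗[k] A)) p : Type) ⊗[k] A →ₗ[k]
      pwr k A (ModuleCat.of k (N ⊗[k] A)) p)
  | 0 => (TensorProduct.map (LinearMap.id : N →ₗ[k] N) (μA k A)).comp
      (TensorProduct.assoc k N A A).toLinearMap
  | p + 1 =>
      (TensorProduct.map (rmulBase p) (LinearMap.id : A →ₗ[k] A)).comp <|
        ((TensorProduct.assoc k (pwr k A (ModuleCat.of k (N ⊗[k] A)) p : Type) A A).symm.toLinearMap).comp <|
          (TensorProduct.map
            (LinearMap.id : (pwr k A (ModuleCat.of k (N ⊗[k] A)) p : Type) →ₗ[k] _)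
            (TensorProduct.comm k A A).toLinearMap).comp
            (TensorProduct.assoc k
              (pwr k A (ModuleCat.of k (N ⊗[k] A)) p : Type) A A).toLinearMap

/-- Apply the counit to the `A`-component of the base `N ⊗ A`. -/
def epsBase : (p : ℕ) →
    ((pwr k A (ModuleCat.of k (N ⊗[k] A)) p : Type) →ₗ[k] pwr k A (ModuleCat.of k N) p)
  | 0 => (TensorProduct.rid k N).toLinearMap.comp
      (TensorProduct.map (LinearMap.id : N →ₗ[k] N) (εA k A))
  | p + 1 => TensorProduct.map (epsBase p) (LinearMap.id : A →ₗ[k] A)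

/-- Apply `Δ` on the `i`-th `A`-slot (`1 ≤ i ≤ p`) of `N ⊗ A^{⊗ p}`; junk otherwise. -/
def comulAt : (p : ℕ) → (i : ℕ) →
    ((pwr k A (ModuleCat.of k N) p : Type) →ₗ[k] pwr k A (ModuleCat.of k N) (p+1))
  | 0, _ => 0
  | p + 1, i =>
      if i = p + 1 then
        ((TensorProduct.assoc k (pwr k A (ModuleCat.of k N) p : Type) A A).symm.toLinearMap).comp
          (TensorProduct.map
            (LinearMap.id : (pwr k A (ModuleCat.of k N) p : Type) →ₗ[k] _) (ΔA k A))
      else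
        TensorProduct.map (comulAt p i) (LinearMap.id : A →ₗ[k] A)

/-- Left coaction on `N ⊗ A^{⊗ p}` coming from a left coaction on the base. -/
def lcoBase (ρNl : N →ₗ[k] A ⊗[k] N) : (p : ℕ) →
    ((pwr k A (ModuleCat.of k N) p : Type) →ₗ[k]
      A ⊗[k] (pwr k A (ModuleCat.of k N) p : Type))
  | 0 => ρNl
  | p + 1 =>
      ((TensorProduct.assoc k A (pwr k A (ModuleCat.of k N) p : Type) A).toLinearMap).comp
        (TensorProduct.map (lcoBase ρNl p) (LinearMap.id : A →ₗ[k] A))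

end Base

section Bicomplex

variable {M N : Type} [AddCommGroup M] [Module k M] [AddCommGroup N] [Module k N]

/-- `A^{⊗ n} ⊗ M`, the domain of the `(n,p)` cochains. -/
abbrev Dm (M : Type) [AddCommGroup M] [Module k M] (n : ℕ) : Type :=
  (Pk k A n : Type) ⊗[k] M

/-- `N ⊗ A^{⊗ p}`. -/
abbrev Cd (N : Type) [AddCommGroup N] [Module k N] (p : ℕ) : Type :=
  (pwr k A (ModuleCat.of k N) p : Type)

/-- The space of `(n,p)` cochains `Hom(A^{⊗ n} ⊗ M, N ⊗ A^{⊗ p})`. -/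
abbrev Yc (M N : Type) [AddCommGroup M] [Module k M] [AddCommGroup N] [Module k N]
    (n p : ℕ) : Type := Dm k A M n →ₗ[k] Cd k A N p

variable (ωM : A ⊗[k] M →ₗ[k] M) (ρM : M →ₗ[k] M ⊗[k] A)
variable (ωN : A ⊗[k] N →ₗ[k] N) (ρN : N →ₗ[k] N ⊗[k] A)

/-- `b_0`: the face using the diagonal left action of `a^1` on `N ⊗ A^{⊗ p}`. -/
def face0 (n p : ℕ) (f : Yc k A M N n p) : Yc k A M N (n+1) p :=
  (ldiag k A ωN p).comp <|
    (TensorProduct.map (LinearMap.id : A →ₗ[k] A) f).comp <|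
      ((TensorProduct.assoc k A (Pk k A n : Type) M).toLinearMap).comp
        (TensorProduct.map (insP k A n).symm.toLinearMap (LinearMap.id : M →ₗ[k] M))

/-- `b_i`, `1 ≤ i ≤ n`: multiply the adjacent arguments `a^i a^{i+1}`. -/
def faceMid (n p : ℕ) (i : ℕ) (f : Yc k A M N n p) : Yc k A M N (n+1) p :=
  f.comp (TensorProduct.map (mulP k A n i) (LinearMap.id : M →ₗ[k] M))

/-- `b_{n+1}` in the Hopf-module case: `f(a^1 ⊗ ⋯ ⊗ a^n ⊗ a^{n+1}·m)`. -/
def faceLastH (n p : ℕ) (f : Yc k A M N n p) : Yc k A M N (n+1) p :=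
  f.comp <|
    (TensorProduct.map (LinearMap.id : (Pk k A n : Type) →ₗ[k] _) ωM).comp
      (TensorProduct.assoc k (Pk k A n : Type) A M).toLinearMap

/-- `b_{n+1}` in the Yetter-Drinfel'd case. -/
def faceLastYD (n p : ℕ) (f : Yc k A M N n p) : Yc k A M N (n+1) p :=
  (rdiagE k A p).comp <|
    ((TensorProduct.comm k A (Cd k A N p)).toLinearMap).comp <|
      (TensorProduct.map (LinearMap.id : A →ₗ[k] A)
        (f.comp (TensorProduct.map (LinearMap.id : (Pk k A n : Type) →ₗ[k] _) ωM))).comp <|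
        ((TensorProduct.leftComm k (Pk k A n : Type) A (A ⊗[k] M)).toLinearMap).comp <|
          (TensorProduct.map (LinearMap.id : (Pk k A n : Type) →ₗ[k] _)
            (TensorProduct.assoc k A A M).toLinearMap).comp <|
            ((TensorProduct.assoc k (Pk k A n : Type) (A ⊗[k] A) M).toLinearMap).comp
              (TensorProduct.map
                (TensorProduct.map (LinearMap.id : (Pk k A n : Type) →ₗ[k] _) (ΔA k A))
                (LinearMap.id : M →ₗ[k] M))

/-- The Yetter-Drinfel'd horizontal faces `b_i^{n,p}`, `0 ≤ i ≤ n+1`. -/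
def bYD (n p : ℕ) (i : ℕ) (f : Yc k A M N n p) : Yc k A M N (n+1) p :=
  if i = 0 then face0 k A ωN n p f
  else if i ≤ n then faceMid k A n p i f
  else faceLastYD k A ωM n p f

/-- The Hopf-module horizontal faces `b_i^{n,p}`, `0 ≤ i ≤ n+1`. -/
def bH (n p : ℕ) (i : ℕ) (f : Yc k A M N n p) : Yc k A M N (n+1) p :=
  if i = 0 then face0 k A ωN n p f
  else if i ≤ n then faceMid k A n p i f
  else faceLastH k A ωM n p f

/-- `c_0` in the Hopf-module case: apply `ρ_N` to the `N`-component of the output. -/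
def cof0H (n p : ℕ) (f : Yc k A M N n p) : Yc k A M N n (p+1) :=
  ((shiftB k A p).toLinearMap).comp ((rhoBase k A ρN p).comp f)

/-- `c_0` in the Yetter-Drinfel'd case. -/
def cof0YD (n p : ℕ) (f : Yc k A M N n p) : Yc k A M N n (p+1) :=
  ((shiftB k A p).toLinearMap).comp <|
    (rmulBase k A p).comp <|
      ((TensorProduct.comm k A
          (pwr k A (ModuleCat.of k (N ⊗[k] A)) p : Type)).toLinearMap).comp <|
        (TensorProduct.map (LinearMap.id : A →ₗ[k] A) ((rhoBase k A ρN p).comp f)).comp <|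
          ((TensorProduct.assoc k A (Pk k A n : Type) M).toLinearMap).comp
            (TensorProduct.map (dL k A n) (LinearMap.id : M →ₗ[k] M))

/-- `c_{p+1}`: uses the right comodule structure of `M`. -/
def cofLast (n p : ℕ) (f : Yc k A M N n p) : Yc k A M N n (p+1) :=
  (TensorProduct.map f (μA k A)).comp <|
    ((TensorProduct.tensorTensorTensorComm k (Pk k A n : Type) A M A).toLinearMap).comp
      (TensorProduct.map (dR k A n) ρM)

/-- The Yetter-Drinfel'd vertical cofaces `c_j^{n,p}`, `0 ≤ j ≤ p+1`. -/
def cYD (n p : ℕ) (j : ℕ) (f : Yc k A M N n p) : Yc k A M N n (p+1) :=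
  if j = 0 then cof0YD k A ρN n p f
  else if j ≤ p then (comulAt k A p j).comp f
  else cofLast k A ρM n p f

/-- The Hopf-module vertical cofaces `c_j^{n,p}`, `0 ≤ j ≤ p+1`. -/
def cH (n p : ℕ) (j : ℕ) (f : Yc k A M N n p) : Yc k A M N n (p+1) :=
  if j = 0 then cof0H k A ρN n p f
  else if j ≤ p then (comulAt k A p j).comp f
  else cofLast k A ρM n p f

/-- The horizontal differential (Yetter-Drinfel'd case). -/
def dmYD (n p : ℕ) (f : Yc k A M N n p) : Yc k A M N (n+1) p :=
  ∑ i ∈ Finset.range (n+2), ((-1 : ℤ)^i) • bYD k A ωM ωN n p i f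

/-- The vertical differential (Yetter-Drinfel'd case). -/
def dcYD (n p : ℕ) (f : Yc k A M N n p) : Yc k A M N n (p+1) :=
  ∑ j ∈ Finset.range (p+2), ((-1 : ℤ)^j) • cYD k A ρM ρN n p j f

/-- The horizontal differential (Hopf-module case). -/
def dmH (n p : ℕ) (f : Yc k A M N n p) : Yc k A M N (n+1) p :=
  ∑ i ∈ Finset.range (n+2), ((-1 : ℤ)^i) • bH k A ωM ωN n p i f

/-- The vertical differential (Hopf-module case). -/
def dcH (n p : ℕ) (f : Yc k A M N n p) : Yc k A M N n (p+1) :=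
  ∑ j ∈ Finset.range (p+2), ((-1 : ℤ)^j) • cH k A ρM ρN n p j f

end Bicomplex

section Structures

variable {M : Type} [AddCommGroup M] [Module k M]

/-- `(M, ωM)` is a left `A`-module. -/
def IsModule (ωM : A ⊗[k] M →ₗ[k] M) : Prop :=
  (∀ m : M, ωM ((1 : A) ⊗ₜ m) = m) ∧
  ∀ (a b : A) (m : M), ωM (a ⊗ₜ ωM (b ⊗ₜ m)) = ωM ((a * b) ⊗ₜ m)

/-- `(M, ρM)` is a right `A`-comodule. -/
def IsComodule (ρM : M →ₗ[k] M ⊗[k] A) : Prop :=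
  ((TensorProduct.rid k M).toLinearMap.comp
      ((TensorProduct.map (LinearMap.id : M →ₗ[k] M) (εA k A)).comp ρM) = LinearMap.id) ∧
  (TensorProduct.map ρM (LinearMap.id : A →ₗ[k] A)).comp ρM =
    ((TensorProduct.assoc k M A A).symm.toLinearMap).comp
      ((TensorProduct.map (LinearMap.id : M →ₗ[k] M) (ΔA k A)).comp ρM)

/-- The map `a ⊗ m ↦ Σ a_1·m_0 ⊗ a_2 m_1`. -/
def hopfRHS (ωM : A ⊗[k] M →ₗ[k] M) (ρM : M →ₗ[k] M ⊗[k] A) :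
    A ⊗[k] M →ₗ[k] M ⊗[k] A :=
  (TensorProduct.map ωM (μA k A)).comp <|
    ((TensorProduct.tensorTensorTensorComm k A A M A).toLinearMap).comp
      (TensorProduct.map (ΔA k A) ρM)

/-- The map `a ⊗ m ↦ Σ (a_2·m)_0 ⊗ (a_2·m)_1 a_1`. -/
def ydLHS (ωM : A ⊗[k] M →ₗ[k] M) (ρM : M →ₗ[k] M ⊗[k] A) :
    A ⊗[k] M →ₗ[k] M ⊗[k] A :=
  (TensorProduct.map (LinearMap.id : M →ₗ[k] M) (μA k A)).comp <|
    ((TensorProduct.assoc k M A A).toLinearMap).comp <|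
      ((TensorProduct.comm k A (M ⊗[k] A)).toLinearMap).comp <|
        (TensorProduct.map (LinearMap.id : A →ₗ[k] A) (ρM.comp ωM)).comp <|
          ((TensorProduct.assoc k A A M).toLinearMap).comp
            (TensorProduct.map (ΔA k A) (LinearMap.id : M →ₗ[k] M))

/-- `(M, ωM, ρM)` is a left-right Yetter-Drinfel'd module over `A`. -/
def IsYetterDrinfeld (ωM : A ⊗[k] M →ₗ[k] M) (ρM : M →ₗ[k] M ⊗[k] A) : Prop :=
  IsModule k A ωM ∧ IsComodule k A ρM ∧
    ydLHS k A ωM ρM = hopfRHS k A ωM ρM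

/-- `(M, ωM, ρM)` is a left-right Hopf module over `A`. -/
def IsHopfModule (ωM : A ⊗[k] M →ₗ[k] M) (ρM : M →ₗ[k] M ⊗[k] A) : Prop :=
  IsModule k A ωM ∧ IsComodule k A ρM ∧
    ρM.comp ωM = hopfRHS k A ωM ρM

end Structures

section Sweedler

open Coalgebra

variable {k A} {V X Y Y' P P' M N : Type}
  [AddCommGroup V] [Module k V]
  [AddCommGroup X] [Module k X] [AddCommGroup Y] [Module k Y]
  [AddCommGroup Y'] [Module k Y'] [AddCommGroup P] [Module k P]
  [AddCommGroup P'] [Module k P'] [AddCommGroup M] [Module k M]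
  [AddCommGroup N] [Module k N]

/-- Coassociativity, evaluated on a function that is linear in each of its three arguments. -/
lemma sum_coassoc (a : A) (T : A → A → A → V)
    (h₁ : ∀ y z, IsLinearMap k fun x => T x y z)
    (h₂ : ∀ x z, IsLinearMap k fun y => T x y z)
    (h₃ : ∀ x y, IsLinearMap k fun z => T x y z) :
    ∑ i ∈ (ℛ k a).index, ∑ j ∈ (ℛ k ((ℛ k a).left i)).index,
        T ((ℛ k ((ℛ k a).left i)).left j) ((ℛ k ((ℛ k a).left i)).right j) ((ℛ k a).right i) =
      ∑ i ∈ (ℛ k a).index, ∑ j ∈ (ℛ k ((ℛ k a).right i)).index,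
        T ((ℛ k a).left i) ((ℛ k ((ℛ k a).right i)).left j)
          ((ℛ k ((ℛ k a).right i)).right j) := by
  have h := sum_tmul_tmul_eq (ℛ k a) (fun i => ℛ k ((ℛ k a).left i))
    (fun i => ℛ k ((ℛ k a).right i))
  let F : A →ₗ[k] (A ⊗[k] A →ₗ[k] V) :=
    { toFun := fun x => TensorProduct.lift
        (LinearMap.mk₂ k (T x) (fun y y' z => (h₂ x z).map_add y y')
          (fun c y z => (h₂ x z).map_smul c y) (fun y z z' => (h₃ x y).map_add z z')
          (fun c y z => (h₃ x y).map_smul c z))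
      map_add' := fun x x' => TensorProduct.ext' fun y z => (h₁ y z).map_add x x'
      map_smul' := fun c x => TensorProduct.ext' fun y z => (h₁ y z).map_smul c x }
  have h' := congrArg (TensorProduct.lift F) h
  simpa only [map_sum, TensorProduct.lift.tmul, F, LinearMap.coe_mk, AddHom.coe_mk,
    LinearMap.mk₂_apply] using h'

lemma sum_counit_left (a : A) (T : A → V) (h : IsLinearMap k T) :
    ∑ i ∈ (ℛ k a).index, εA k A ((ℛ k a).left i) • T ((ℛ k a).right i) = T a := by
  have h' := congrArg (h.mk' T) (sum_counit_smul (ℛ k a))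
  simpa using h'

lemma sum_counit_right (a : A) (T : A → V) (h : IsLinearMap k T) :
    ∑ i ∈ (ℛ k a).index, εA k A ((ℛ k a).right i) • T ((ℛ k a).left i) = T a := by
  have h' := congrArg (TensorProduct.rid k V) (sum_map_tmul_counit_eq (h.mk' T) a (repr := ℛ k a))
  simpa using h'

/-- Extension of a left action to `X ⊗ A` by the diagonal action, as in `ldiag`. -/
def ldiagStep (l : A ⊗[k] X →ₗ[k] X) : A ⊗[k] (X ⊗[k] A) →ₗ[k] X ⊗[k] A :=
  (TensorProduct.map l (μA k A)).comp <|
    ((TensorProduct.tensorTensorTensorComm k A A X A).toLinearMap).comp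
      (TensorProduct.map (ΔA k A) (LinearMap.id : (X ⊗[k] A) →ₗ[k] _))

/-- Extension of a right action to `X ⊗ A` by the diagonal action, as in `rdiagE`. -/
def rdiagStep (r : X ⊗[k] A →ₗ[k] X) : (X ⊗[k] A) ⊗[k] A →ₗ[k] X ⊗[k] A :=
  (TensorProduct.map r (μA k A)).comp <|
    ((TensorProduct.tensorTensorTensorComm k X A A A).toLinearMap).comp
      (TensorProduct.map (LinearMap.id : (X ⊗[k] A) →ₗ[k] _) (ΔA k A))

/-- Apply the comultiplication to the last slot. -/
def comulLast (X : Type) [AddCommGroup X] [Module k X] : X ⊗[k] A →ₗ[k] (X ⊗[k] A) ⊗[k] A :=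
  ((TensorProduct.assoc k X A A).symm.toLinearMap).comp
    (TensorProduct.map (LinearMap.id : X →ₗ[k] _) (ΔA k A))

/-- Extension of a left coaction to `P ⊗ A` by the codiagonal coaction, as in `dL`. -/
def dLStep (d : P →ₗ[k] A ⊗[k] P) : P ⊗[k] A →ₗ[k] A ⊗[k] (P ⊗[k] A) :=
  (TensorProduct.map (μA k A) (LinearMap.id : (P ⊗[k] A) →ₗ[k] _)).comp <|
    ((TensorProduct.tensorTensorTensorComm k A P A A).toLinearMap).comp
      (TensorProduct.map d (ΔA k A))

/-- Extension of a right coaction to `P ⊗ A` by the codiagonal coaction, as in `dR`. -/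
def dRStep (d : P →ₗ[k] P ⊗[k] A) : P ⊗[k] A →ₗ[k] (P ⊗[k] A) ⊗[k] A :=
  (TensorProduct.map (LinearMap.id : (P ⊗[k] A) →ₗ[k] _) (μA k A)).comp <|
    ((TensorProduct.tensorTensorTensorComm k P A A A).toLinearMap).comp
      (TensorProduct.map d (ΔA k A))

lemma ldiagStep_tmul (l : A ⊗[k] X →ₗ[k] X) (a b : A) (x : X) :
    ldiagStep l (a ⊗ₜ (x ⊗ₜ b)) =
      ∑ i ∈ (ℛ k a).index, l ((ℛ k a).left i ⊗ₜ x) ⊗ₜ[k] ((ℛ k a).right i * b) := by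
  simp [ldiagStep, ΔA, ← (ℛ k a).eq, TensorProduct.sum_tmul]

lemma rdiagStep_tmul (r : X ⊗[k] A →ₗ[k] X) (a b : A) (x : X) :
    rdiagStep r ((x ⊗ₜ b) ⊗ₜ a) =
      ∑ i ∈ (ℛ k a).index, r (x ⊗ₜ (ℛ k a).left i) ⊗ₜ[k] (b * (ℛ k a).right i) := by
  simp [rdiagStep, ΔA, ← (ℛ k a).eq, TensorProduct.tmul_sum]

lemma ldiagStep_map (l : A ⊗[k] X →ₗ[k] X) (l' : A ⊗[k] Y →ₗ[k] Y) (c : X →ₗ[k] Y)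
    (h : ∀ a x, c (l (a ⊗ₜ x)) = l' (a ⊗ₜ c x)) (a : A) (x : X ⊗[k] A) :
    TensorProduct.map c LinearMap.id (ldiagStep l (a ⊗ₜ x)) =
      ldiagStep l' (a ⊗ₜ TensorProduct.map c LinearMap.id x) := by
  induction x with
  | zero => simp
  | add x y hx hy => simp only [TensorProduct.tmul_add, map_add, hx, hy]
  | tmul x b => simp [ldiagStep_tmul, h]

lemma rdiagStep_map (r : X ⊗[k] A →ₗ[k] X) (r' : Y ⊗[k] A →ₗ[k] Y) (c : X →ₗ[k] Y)
    (h : ∀ x a, c (r (x ⊗ₜ a)) = r' (c x ⊗ₜ a)) (x : X ⊗[k] A) (a : A) :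
    TensorProduct.map c LinearMap.id (rdiagStep r (x ⊗ₜ a)) =
      rdiagStep r' (TensorProduct.map c LinearMap.id x ⊗ₜ a) := by
  induction x with
  | zero => simp
  | add x y hx hy => simp only [TensorProduct.add_tmul, map_add, hx, hy]
  | tmul x b => simp [rdiagStep_tmul, h]

lemma ldiagStep_comulLast (l : A ⊗[k] X →ₗ[k] X) (a : A) (x : X ⊗[k] A) :
    comulLast X (ldiagStep l (a ⊗ₜ x)) =
      ldiagStep (ldiagStep l) (a ⊗ₜ comulLast X x) := by
  induction x with
  | zero => simp
  | add x y hx hy => simp only [TensorProduct.tmul_add, map_add, hx, hy]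
  | tmul x b =>
    have key : ∀ t : A ⊗[k] A,
        ∑ i ∈ (ℛ k a).index, (TensorProduct.assoc k X A A).symm
          (l ((ℛ k a).left i ⊗ₜ x) ⊗ₜ[k] (ΔA k A ((ℛ k a).right i) * t)) =
        ldiagStep (ldiagStep l) (a ⊗ₜ (TensorProduct.assoc k X A A).symm (x ⊗ₜ t)) := by
      intro t
      induction t with
      | zero => simp
      | add s t hs ht =>
        simp only [mul_add, TensorProduct.tmul_add, map_add, Finset.sum_add_distrib, hs, ht]
      | tmul u v =>
        simp only [TensorProduct.assoc_symm_tmul, ldiagStep_tmul, TensorProduct.sum_tmul]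
        rw [sum_coassoc a (fun y z w => (l (y ⊗ₜ x) ⊗ₜ[k] (z * u)) ⊗ₜ[k] (w * v))]
        · simp [ΔA, ← (ℛ k ((ℛ k a).right _)).eq, Finset.sum_mul, TensorProduct.tmul_sum]
        all_goals
          intros
          constructor <;> intros <;>
            simp [TensorProduct.add_tmul, TensorProduct.tmul_add, add_mul,
              ← TensorProduct.smul_tmul']
    simpa [comulLast, ldiagStep_tmul, Bialgebra.comul_mul] using key (ΔA k A b)

lemma rdiagStep_comulLast (r : X ⊗[k] A →ₗ[k] X) (x : X ⊗[k] A) (a : A) :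
    comulLast X (rdiagStep r (x ⊗ₜ a)) =
      rdiagStep (rdiagStep r) (comulLast X x ⊗ₜ a) := by
  induction x with
  | zero => simp
  | add x y hx hy => simp only [TensorProduct.add_tmul, map_add, hx, hy]
  | tmul x b =>
    have key : ∀ t : A ⊗[k] A,
        ∑ i ∈ (ℛ k a).index, (TensorProduct.assoc k X A A).symm
          (r (x ⊗ₜ (ℛ k a).left i) ⊗ₜ[k] (t * ΔA k A ((ℛ k a).right i))) =
        rdiagStep (rdiagStep r) ((TensorProduct.assoc k X A A).symm (x ⊗ₜ t) ⊗ₜ a) := by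
      intro t
      induction t with
      | zero => simp
      | add s t hs ht =>
        simp only [add_mul, TensorProduct.tmul_add, TensorProduct.add_tmul, map_add,
          Finset.sum_add_distrib, hs, ht]
      | tmul u v =>
        simp only [TensorProduct.assoc_symm_tmul, rdiagStep_tmul, TensorProduct.sum_tmul]
        rw [sum_coassoc a (fun y z w => (r (x ⊗ₜ y) ⊗ₜ[k] (u * z)) ⊗ₜ[k] (v * w))]
        · simp [ΔA, ← (ℛ k ((ℛ k a).right _)).eq, Finset.mul_sum, TensorProduct.tmul_sum]
        all_goals
          intros
          constructor <;> intros <;>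
            simp [TensorProduct.add_tmul, TensorProduct.tmul_add, mul_add,
              ← TensorProduct.smul_tmul']
    simpa [comulLast, rdiagStep_tmul, Bialgebra.comul_mul] using key (ΔA k A b)

/-- If `T (a₂ · y ⊗ a₁ b) = a · T (y ⊗ b)`, then the same holds one slot further. -/
lemma ldiagStep_twist (l : A ⊗[k] Y →ₗ[k] Y) (l' : A ⊗[k] Y' →ₗ[k] Y')
    (T : Y ⊗[k] A →ₗ[k] Y') (T' : (Y ⊗[k] A) ⊗[k] A →ₗ[k] Y' ⊗[k] A)
    (hT : ∀ y c b, T' ((y ⊗ₜ c) ⊗ₜ b) = T (y ⊗ₜ b) ⊗ₜ c)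
    (h : ∀ a y b, ∑ i ∈ (ℛ k a).index, T (l ((ℛ k a).right i ⊗ₜ y) ⊗ₜ ((ℛ k a).left i * b)) =
      l' (a ⊗ₜ T (y ⊗ₜ b)))
    (a : A) (y : Y ⊗[k] A) (b : A) :
    ∑ i ∈ (ℛ k a).index, T' (ldiagStep l ((ℛ k a).right i ⊗ₜ y) ⊗ₜ ((ℛ k a).left i * b)) =
      ldiagStep l' (a ⊗ₜ T' (y ⊗ₜ b)) := by
  induction y with
  | zero => simp
  | add x y hx hy =>
    simp only [TensorProduct.tmul_add, TensorProduct.add_tmul, map_add, Finset.sum_add_distrib,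
      hx, hy]
  | tmul y c =>
    simp only [ldiagStep_tmul, hT, ← h, TensorProduct.sum_tmul, map_sum]
    rw [sum_coassoc a (fun u v w => T (l (v ⊗ₜ y) ⊗ₜ (u * b)) ⊗ₜ[k] (w * c))]
    all_goals
      intros
      constructor <;> intros <;>
        simp [TensorProduct.add_tmul, TensorProduct.tmul_add, add_mul,
          ← TensorProduct.smul_tmul']

lemma rdiagStep_twist (r : Y ⊗[k] A →ₗ[k] Y) (r' : Y' ⊗[k] A →ₗ[k] Y')
    (T : Y ⊗[k] A →ₗ[k] Y') (T' : (Y ⊗[k] A) ⊗[k] A →ₗ[k] Y' ⊗[k] A)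
    (hT : ∀ y c b, T' ((y ⊗ₜ c) ⊗ₜ b) = T (y ⊗ₜ b) ⊗ₜ c)
    (h : ∀ y a b, ∑ i ∈ (ℛ k a).index, T (r (y ⊗ₜ (ℛ k a).right i) ⊗ₜ (b * (ℛ k a).left i)) =
      r' (T (y ⊗ₜ b) ⊗ₜ a))
    (y : Y ⊗[k] A) (a b : A) :
    ∑ i ∈ (ℛ k a).index, T' (rdiagStep r (y ⊗ₜ (ℛ k a).right i) ⊗ₜ (b * (ℛ k a).left i)) =
      rdiagStep r' (T' (y ⊗ₜ b) ⊗ₜ a) := by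
  induction y with
  | zero => simp
  | add x y hx hy =>
    simp only [TensorProduct.add_tmul, map_add, Finset.sum_add_distrib, hx, hy]
  | tmul y c =>
    simp only [rdiagStep_tmul, hT, ← h, TensorProduct.sum_tmul, map_sum]
    rw [sum_coassoc a (fun u v w => T (r (y ⊗ₜ v) ⊗ₜ (b * u)) ⊗ₜ[k] (c * w))]
    all_goals
      intros
      constructor <;> intros <;>
        simp [TensorProduct.add_tmul, TensorProduct.tmul_add, mul_add,
          ← TensorProduct.smul_tmul']



lemma dLStep_map (d : P →ₗ[k] A ⊗[k] P) (d' : P' →ₗ[k] A ⊗[k] P') (c : P →ₗ[k] P')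
    (h : ∀ x, d' (c x) = TensorProduct.map LinearMap.id c (d x)) (x : P ⊗[k] A) :
    dLStep d' (TensorProduct.map c LinearMap.id x) =
      TensorProduct.map LinearMap.id (TensorProduct.map c LinearMap.id) (dLStep d x) := by
  induction x with
  | zero => simp
  | add x y hx hy => simp only [map_add, hx, hy]
  | tmul x b =>
    simp only [dLStep, LinearMap.comp_apply, TensorProduct.map_tmul, h]
    generalize d x = s
    generalize ΔA k A b = t
    induction s with
    | zero => simp
    | add _ _ h h' => simp only [TensorProduct.add_tmul, map_add, h, h']
    | tmul u y =>
      induction t with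
      | zero => simp
      | add _ _ h h' => simp only [TensorProduct.tmul_add, map_add, h, h']
      | tmul b₁ b₂ => simp

lemma dRStep_map (d : P →ₗ[k] P ⊗[k] A) (d' : P' →ₗ[k] P' ⊗[k] A) (c : P →ₗ[k] P')
    (h : ∀ x, d' (c x) = TensorProduct.map c LinearMap.id (d x)) (x : P ⊗[k] A) :
    dRStep d' (TensorProduct.map c LinearMap.id x) =
      TensorProduct.map (TensorProduct.map c LinearMap.id) LinearMap.id (dRStep d x) := by
  induction x with
  | zero => simp
  | add x y hx hy => simp only [map_add, hx, hy]
  | tmul x b =>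
    simp only [dRStep, LinearMap.comp_apply, TensorProduct.map_tmul, h]
    generalize d x = s
    generalize ΔA k A b = t
    induction s with
    | zero => simp
    | add _ _ h h' => simp only [TensorProduct.add_tmul, map_add, h, h']
    | tmul u y =>
      induction t with
      | zero => simp
      | add _ _ h h' => simp only [TensorProduct.tmul_add, map_add, h, h']
      | tmul b₁ b₂ => simp

/-- Multiply the last two slots. -/
def mulLast (P : Type) [AddCommGroup P] [Module k P] : (P ⊗[k] A) ⊗[k] A →ₗ[k] P ⊗[k] A :=
  (TensorProduct.map (LinearMap.id : P →ₗ[k] P) (μA k A)).comp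
    (TensorProduct.assoc k P A A).toLinearMap

lemma dLStep_mulLast (d : P →ₗ[k] A ⊗[k] P) (x : (P ⊗[k] A) ⊗[k] A) :
    dLStep d (mulLast P x) =
      TensorProduct.map LinearMap.id (mulLast P) (dLStep (dLStep d) x) := by
  induction x with
  | zero => simp
  | add x y hx hy => simp only [map_add, hx, hy]
  | tmul x c =>
    induction x with
    | zero => simp
    | add x y hx hy => simp only [TensorProduct.add_tmul, map_add, hx, hy]
    | tmul x b =>
      simp only [dLStep, mulLast, LinearMap.comp_apply, TensorProduct.map_tmul,
        LinearEquiv.coe_coe, TensorProduct.assoc_tmul, LinearMap.id_apply, LinearMap.mul'_apply,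
        Bialgebra.comul_mul]
      generalize d x = s
      generalize ΔA k A b = t
      generalize ΔA k A c = v
      induction s with
      | zero => simp
      | add _ _ h h' => simp only [TensorProduct.add_tmul, map_add, h, h']
      | tmul u y =>
        induction t with
        | zero => simp
        | add _ _ h h' =>
          simp only [TensorProduct.add_tmul, TensorProduct.tmul_add, add_mul, map_add, h, h']
        | tmul b₁ b₂ =>
          induction v with
          | zero => simp
          | add _ _ h h' => simp only [TensorProduct.tmul_add, mul_add, map_add, h, h']
          | tmul c₁ c₂ => simp [mul_assoc]

lemma dRStep_mulLast (d : P →ₗ[k] P ⊗[k] A) (x : (P ⊗[k] A) ⊗[k] A) :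
    dRStep d (mulLast P x) =
      TensorProduct.map (mulLast P) LinearMap.id (dRStep (dRStep d) x) := by
  induction x with
  | zero => simp
  | add x y hx hy => simp only [map_add, hx, hy]
  | tmul x c =>
    induction x with
    | zero => simp
    | add x y hx hy => simp only [TensorProduct.add_tmul, map_add, hx, hy]
    | tmul x b =>
      simp only [dRStep, mulLast, LinearMap.comp_apply, TensorProduct.map_tmul,
        LinearEquiv.coe_coe, TensorProduct.assoc_tmul, LinearMap.id_apply, LinearMap.mul'_apply,
        Bialgebra.comul_mul]
      generalize d x = s
      generalize ΔA k A b = t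
      generalize ΔA k A c = v
      induction s with
      | zero => simp
      | add _ _ h h' => simp only [TensorProduct.add_tmul, map_add, h, h']
      | tmul y u =>
        induction t with
        | zero => simp
        | add _ _ h h' =>
          simp only [TensorProduct.add_tmul, TensorProduct.tmul_add, add_mul, map_add, h, h']
        | tmul b₁ b₂ =>
          induction v with
          | zero => simp
          | add _ _ h h' => simp only [TensorProduct.tmul_add, mul_add, map_add, h, h']
          | tmul c₁ c₂ => simp [mul_assoc]

/-- The codiagonal left coaction on `A ⊗ P`, with `A ⊗ P` mapped to `P'` afterwards. -/
def dLIns (ins : A ⊗[k] P →ₗ[k] P') : (A ⊗[k] A) ⊗[k] (A ⊗[k] P) →ₗ[k] A ⊗[k] P' :=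
  (TensorProduct.map (μA k A) ins).comp
    (TensorProduct.tensorTensorTensorComm k A A A P).toLinearMap

/-- The codiagonal right coaction on `A ⊗ P`, with `A ⊗ P` mapped to `P'` afterwards. -/
def dRIns (ins : A ⊗[k] P →ₗ[k] P') : (A ⊗[k] A) ⊗[k] (P ⊗[k] A) →ₗ[k] P' ⊗[k] A :=
  (TensorProduct.map ins (μA k A)).comp
    (TensorProduct.tensorTensorTensorComm k A A P A).toLinearMap

lemma dLStep_ins (ins : A ⊗[k] P →ₗ[k] P') (ins' : A ⊗[k] (P ⊗[k] A) →ₗ[k] P' ⊗[k] A)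
    (hins : ∀ a x b, ins' (a ⊗ₜ (x ⊗ₜ b)) = ins (a ⊗ₜ x) ⊗ₜ b)
    (d : P →ₗ[k] A ⊗[k] P) (d' : P' →ₗ[k] A ⊗[k] P')
    (h : ∀ a x, d' (ins (a ⊗ₜ x)) = dLIns ins (ΔA k A a ⊗ₜ d x)) (a : A) (x : P ⊗[k] A) :
    dLStep d' (ins' (a ⊗ₜ x)) = dLIns ins' (ΔA k A a ⊗ₜ dLStep d x) := by
  induction x with
  | zero => simp
  | add x y hx hy => simp only [TensorProduct.tmul_add, map_add, hx, hy]
  | tmul x b =>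
    simp only [dLStep, hins, LinearMap.comp_apply, TensorProduct.map_tmul, h]
    generalize d x = s
    generalize ΔA k A b = t
    generalize ΔA k A a = v
    induction s with
    | zero => simp
    | add _ _ h h' => simp only [TensorProduct.add_tmul, TensorProduct.tmul_add, map_add, h, h']
    | tmul u y =>
      induction t with
      | zero => simp
      | add _ _ h h' => simp only [TensorProduct.tmul_add, map_add, h, h']
      | tmul b₁ b₂ =>
        induction v with
        | zero => simp
        | add _ _ h h' => simp only [TensorProduct.add_tmul, map_add, h, h']
        | tmul c₁ c₂ => simp [dLIns, mul_assoc, hins]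

lemma dRStep_ins (ins : A ⊗[k] P →ₗ[k] P') (ins' : A ⊗[k] (P ⊗[k] A) →ₗ[k] P' ⊗[k] A)
    (hins : ∀ a x b, ins' (a ⊗ₜ (x ⊗ₜ b)) = ins (a ⊗ₜ x) ⊗ₜ b)
    (d : P →ₗ[k] P ⊗[k] A) (d' : P' →ₗ[k] P' ⊗[k] A)
    (h : ∀ a x, d' (ins (a ⊗ₜ x)) = dRIns ins (ΔA k A a ⊗ₜ d x)) (a : A) (x : P ⊗[k] A) :
    dRStep d' (ins' (a ⊗ₜ x)) = dRIns ins' (ΔA k A a ⊗ₜ dRStep d x) := by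
  induction x with
  | zero => simp
  | add x y hx hy => simp only [TensorProduct.tmul_add, map_add, hx, hy]
  | tmul x b =>
    simp only [dRStep, hins, LinearMap.comp_apply, TensorProduct.map_tmul, h]
    generalize d x = s
    generalize ΔA k A b = t
    generalize ΔA k A a = v
    induction s with
    | zero => simp
    | add _ _ h h' => simp only [TensorProduct.add_tmul, TensorProduct.tmul_add, map_add, h, h']
    | tmul y u =>
      induction t with
      | zero => simp
      | add _ _ h h' => simp only [TensorProduct.tmul_add, map_add, h, h']
      | tmul b₁ b₂ =>
        induction v with
        | zero => simp
        | add _ _ h h' => simp only [TensorProduct.add_tmul, map_add, h, h']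
        | tmul c₁ c₂ => simp [dRIns, mul_assoc, hins]

/-- The map `ins (a ⊗ x) ⊗ m ↦ a · f (x ⊗ m)`. -/
def firstFace (ins : A ⊗[k] P ≃ₗ[k] P') (l : A ⊗[k] Y →ₗ[k] Y) (f : P ⊗[k] M →ₗ[k] Y) :
    P' ⊗[k] M →ₗ[k] Y :=
  l.comp <| (TensorProduct.map (LinearMap.id : A →ₗ[k] A) f).comp <|
    ((TensorProduct.assoc k A P M).toLinearMap).comp
      (TensorProduct.map ins.symm.toLinearMap (LinearMap.id : M →ₗ[k] M))

/-- The map `(x ⊗ a) ⊗ m ↦ Σ f (x ⊗ a₂ · m) · a₁`. -/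
def lastFace (r : Y ⊗[k] A →ₗ[k] Y) (ω : A ⊗[k] M →ₗ[k] M) (f : P ⊗[k] M →ₗ[k] Y) :
    (P ⊗[k] A) ⊗[k] M →ₗ[k] Y :=
  r.comp <| ((TensorProduct.comm k A Y).toLinearMap).comp <|
    (TensorProduct.map (LinearMap.id : A →ₗ[k] A)
      (f.comp (TensorProduct.map (LinearMap.id : P →ₗ[k] _) ω))).comp <|
      ((TensorProduct.leftComm k P A (A ⊗[k] M)).toLinearMap).comp <|
        (TensorProduct.map (LinearMap.id : P →ₗ[k] _)
          (TensorProduct.assoc k A A M).toLinearMap).comp <|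
          ((TensorProduct.assoc k P (A ⊗[k] A) M).toLinearMap).comp
            (TensorProduct.map (TensorProduct.map (LinearMap.id : P →ₗ[k] _) (ΔA k A))
              (LinearMap.id : M →ₗ[k] M))

/-- The map `x ⊗ m ↦ Σ T (f (x₀ ⊗ m) ⊗ x₋₁)`, where `d x = Σ x₋₁ ⊗ x₀`. -/
def firstCoface (d : P →ₗ[k] A ⊗[k] P) (T : Y ⊗[k] A →ₗ[k] Y') (f : P ⊗[k] M →ₗ[k] Y) :
    P ⊗[k] M →ₗ[k] Y' :=
  T.comp <| ((TensorProduct.comm k A Y).toLinearMap).comp <|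
    (TensorProduct.map (LinearMap.id : A →ₗ[k] A) f).comp <|
      ((TensorProduct.assoc k A P M).toLinearMap).comp
        (TensorProduct.map d (LinearMap.id : M →ₗ[k] M))

/-- The map `x ⊗ m ↦ Σ f (x₀ ⊗ m₀) ⊗ x₁ m₁`. -/
def lastCoface (d : P →ₗ[k] P ⊗[k] A) (ρ : M →ₗ[k] M ⊗[k] A) (f : P ⊗[k] M →ₗ[k] Y) :
    P ⊗[k] M →ₗ[k] Y ⊗[k] A :=
  (TensorProduct.map f (μA k A)).comp <|
    ((TensorProduct.tensorTensorTensorComm k P A M A).toLinearMap).comp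
      (TensorProduct.map d ρ)

lemma firstFace_tmul (ins : A ⊗[k] P ≃ₗ[k] P') (l : A ⊗[k] Y →ₗ[k] Y)
    (f : P ⊗[k] M →ₗ[k] Y) (a : A) (x : P) (m : M) :
    firstFace ins l f (ins (a ⊗ₜ x) ⊗ₜ m) = l (a ⊗ₜ f (x ⊗ₜ m)) := by
  simp [firstFace]

lemma lastFace_tmul (r : Y ⊗[k] A →ₗ[k] Y) (ω : A ⊗[k] M →ₗ[k] M) (f : P ⊗[k] M →ₗ[k] Y)
    (x : P) (a : A) (m : M) :
    lastFace r ω f ((x ⊗ₜ a) ⊗ₜ m) = ∑ i ∈ (ℛ k a).index,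
      r (f (x ⊗ₜ ω ((ℛ k a).right i ⊗ₜ m)) ⊗ₜ (ℛ k a).left i) := by
  simp [lastFace, ΔA, ← (ℛ k a).eq, TensorProduct.tmul_sum, TensorProduct.sum_tmul]

lemma ext_ins (ins : A ⊗[k] P ≃ₗ[k] P') {g g' : P' ⊗[k] M →ₗ[k] V}
    (h : ∀ a x m, g (ins (a ⊗ₜ x) ⊗ₜ m) = g' (ins (a ⊗ₜ x) ⊗ₜ m)) : g = g' := by
  refine TensorProduct.ext' fun z m => ?_
  obtain ⟨w, rfl⟩ := ins.surjective z
  induction w with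
  | zero => simp
  | add x y hx hy => simp only [map_add, TensorProduct.add_tmul, hx, hy]
  | tmul a x => exact h a x m

lemma firstFace_comp (ins : A ⊗[k] P ≃ₗ[k] P') (l : A ⊗[k] Y →ₗ[k] Y)
    (l' : A ⊗[k] Y' →ₗ[k] Y') (c : Y →ₗ[k] Y') (h : ∀ a y, c (l (a ⊗ₜ y)) = l' (a ⊗ₜ c y))
    (f : P ⊗[k] M →ₗ[k] Y) :
    c.comp (firstFace ins l f) = firstFace ins l' (c.comp f) :=
  ext_ins ins fun a x m => by simp [firstFace_tmul, h]

lemma lastFace_comp (r : Y ⊗[k] A →ₗ[k] Y) (r' : Y' ⊗[k] A →ₗ[k] Y')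
    (ω : A ⊗[k] M →ₗ[k] M) (c : Y →ₗ[k] Y') (h : ∀ y a, c (r (y ⊗ₜ a)) = r' (c y ⊗ₜ a))
    (f : P ⊗[k] M →ₗ[k] Y) :
    c.comp (lastFace r ω f) = lastFace r' ω (c.comp f) :=
  TensorProduct.ext_threefold fun x a m => by simp [lastFace_tmul, h]

lemma firstCoface_comp (d : P →ₗ[k] A ⊗[k] P) (d' : P' →ₗ[k] A ⊗[k] P') (c : P' →ₗ[k] P)
    (h : ∀ x, d (c x) = TensorProduct.map LinearMap.id c (d' x))
    (T : Y ⊗[k] A →ₗ[k] Y') (f : P ⊗[k] M →ₗ[k] Y) :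
    firstCoface d' T (f.comp (TensorProduct.map c LinearMap.id)) =
      (firstCoface d T f).comp (TensorProduct.map c LinearMap.id) := by
  refine TensorProduct.ext' fun x m => ?_
  simp only [firstCoface, LinearMap.comp_apply, TensorProduct.map_tmul, h, LinearMap.id_apply]
  generalize d' x = s
  induction s with
  | zero => simp
  | add _ _ h h' => simp only [TensorProduct.add_tmul, map_add, h, h']
  | tmul u y => simp

lemma lastCoface_comp (d : P →ₗ[k] P ⊗[k] A) (d' : P' →ₗ[k] P' ⊗[k] A) (c : P' →ₗ[k] P)
    (h : ∀ x, d (c x) = TensorProduct.map c LinearMap.id (d' x))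
    (ρ : M →ₗ[k] M ⊗[k] A) (f : P ⊗[k] M →ₗ[k] Y) :
    lastCoface d' ρ (f.comp (TensorProduct.map c LinearMap.id)) =
      (lastCoface d ρ f).comp (TensorProduct.map c LinearMap.id) := by
  refine TensorProduct.ext' fun x m => ?_
  simp only [lastCoface, LinearMap.comp_apply, TensorProduct.map_tmul, h, LinearMap.id_apply]
  generalize d' x = s
  generalize ρ m = t
  induction s with
  | zero => simp
  | add _ _ h h' => simp only [TensorProduct.add_tmul, map_add, h, h']
  | tmul u y =>
    induction t with
    | zero => simp
    | add _ _ h h' => simp only [TensorProduct.tmul_add, map_add, h, h']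
    | tmul n v => simp

lemma firstCoface_firstFace (ins : A ⊗[k] P ≃ₗ[k] P')
    (d : P →ₗ[k] A ⊗[k] P) (d' : P' →ₗ[k] A ⊗[k] P')
    (hd : ∀ a x, d' (ins (a ⊗ₜ x)) = dLIns ins.toLinearMap (ΔA k A a ⊗ₜ d x))
    (l : A ⊗[k] Y →ₗ[k] Y) (l' : A ⊗[k] Y' →ₗ[k] Y') (T : Y ⊗[k] A →ₗ[k] Y')
    (h : ∀ a y b, ∑ i ∈ (ℛ k a).index, T (l ((ℛ k a).right i ⊗ₜ y) ⊗ₜ ((ℛ k a).left i * b)) =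
      l' (a ⊗ₜ T (y ⊗ₜ b)))
    (f : P ⊗[k] M →ₗ[k] Y) :
    firstCoface d' T (firstFace ins l f) = firstFace ins l' (firstCoface d T f) := by
  refine ext_ins ins fun a x m => ?_
  rw [firstFace_tmul]
  simp only [firstCoface, LinearMap.comp_apply, TensorProduct.map_tmul, hd, LinearMap.id_apply]
  generalize d x = s
  induction s with
  | zero => simp
  | add _ _ h h' => simp only [TensorProduct.add_tmul, TensorProduct.tmul_add, map_add, h, h']
  | tmul u y =>
    simp [← h, dLIns, ΔA, ← (ℛ k a).eq, TensorProduct.sum_tmul, firstFace_tmul]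

lemma lastCoface_firstFace (ins : A ⊗[k] P ≃ₗ[k] P')
    (d : P →ₗ[k] P ⊗[k] A) (d' : P' →ₗ[k] P' ⊗[k] A)
    (hd : ∀ a x, d' (ins (a ⊗ₜ x)) = dRIns ins.toLinearMap (ΔA k A a ⊗ₜ d x))
    (l : A ⊗[k] Y →ₗ[k] Y) (ρ : M →ₗ[k] M ⊗[k] A) (f : P ⊗[k] M →ₗ[k] Y) :
    lastCoface d' ρ (firstFace ins l f) =
      firstFace ins (ldiagStep l) (lastCoface d ρ f) := by
  refine ext_ins ins fun a x m => ?_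
  rw [firstFace_tmul]
  simp only [lastCoface, LinearMap.comp_apply, TensorProduct.map_tmul, hd]
  generalize d x = s
  generalize ρ m = t
  induction s with
  | zero => simp
  | add _ _ h h' => simp only [TensorProduct.add_tmul, TensorProduct.tmul_add, map_add, h, h']
  | tmul y u =>
    induction t with
    | zero => simp
    | add _ _ h h' => simp only [TensorProduct.tmul_add, map_add, h, h']
    | tmul n v =>
      simp [ldiagStep_tmul, dRIns, ΔA, ← (ℛ k a).eq, TensorProduct.sum_tmul, firstFace_tmul,
        mul_assoc]

lemma firstCoface_lastFace (d : P →ₗ[k] A ⊗[k] P)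
    (r : Y ⊗[k] A →ₗ[k] Y) (r' : Y' ⊗[k] A →ₗ[k] Y') (T : Y ⊗[k] A →ₗ[k] Y')
    (h : ∀ y a b, ∑ i ∈ (ℛ k a).index, T (r (y ⊗ₜ (ℛ k a).right i) ⊗ₜ (b * (ℛ k a).left i)) =
      r' (T (y ⊗ₜ b) ⊗ₜ a))
    (ω : A ⊗[k] M →ₗ[k] M) (f : P ⊗[k] M →ₗ[k] Y) :
    firstCoface (dLStep d) T (lastFace r ω f) = lastFace r' ω (firstCoface d T f) := by
  refine TensorProduct.ext_threefold fun x a m => ?_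
  rw [lastFace_tmul]
  simp only [firstCoface, dLStep, LinearMap.comp_apply, TensorProduct.map_tmul,
    LinearMap.id_apply]
  generalize d x = s
  induction s with
  | zero => simp
  | add _ _ h h' =>
    simp only [TensorProduct.add_tmul, map_add, Finset.sum_add_distrib, h, h']
  | tmul u y =>
    simp only [LinearEquiv.coe_coe, TensorProduct.assoc_tmul, TensorProduct.map_tmul,
      TensorProduct.comm_tmul, LinearMap.id_apply, ← h]
    rw [sum_coassoc a (fun v w z => T (r (f (y ⊗ₜ ω (z ⊗ₜ m)) ⊗ₜ w) ⊗ₜ (u * v)))]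
    · simp [ΔA, ← (ℛ k a).eq, TensorProduct.sum_tmul, TensorProduct.tmul_sum, lastFace_tmul]
    all_goals
      intros
      constructor <;> intros <;>
        simp [TensorProduct.add_tmul, TensorProduct.tmul_add, mul_add,
          ← TensorProduct.smul_tmul']

lemma lastCoface_lastFace (d : P →ₗ[k] P ⊗[k] A) (r : Y ⊗[k] A →ₗ[k] Y)
    (ω : A ⊗[k] M →ₗ[k] M) (ρ : M →ₗ[k] M ⊗[k] A) (hM : ydLHS k A ω ρ = hopfRHS k A ω ρ)
    (f : P ⊗[k] M →ₗ[k] Y) :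
    lastCoface (dRStep d) ρ (lastFace r ω f) =
      lastFace (rdiagStep r) ω (lastCoface d ρ f) := by
  refine TensorProduct.ext_threefold fun x a m => ?_
  rw [lastFace_tmul]
  simp only [lastCoface, dRStep, LinearMap.comp_apply, TensorProduct.map_tmul]
  generalize d x = s
  induction s with
  | zero => simp
  | add _ _ h h' =>
    simp only [TensorProduct.add_tmul, map_add, Finset.sum_add_distrib, h, h']
  | tmul y u =>
    obtain ⟨G, hG⟩ : ∃ G : A →ₗ[k] M ⊗[k] A →ₗ[k] Y ⊗[k] A,
        ∀ v n b, G v (n ⊗ₜ b) = r (f (y ⊗ₜ n) ⊗ₜ v) ⊗ₜ (u * b) :=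
      ⟨(TensorProduct.mapBilinear (.id k) M A Y A).flip (LinearMap.mulLeft k u) ∘ₗ
        (TensorProduct.curry r ∘ₗ f ∘ₗ TensorProduct.mk k P M y).flip, fun _ _ _ => by simp⟩
    obtain ⟨K, hK⟩ : ∃ K : A →ₗ[k] M ⊗[k] A →ₗ[k] M ⊗[k] A,
        ∀ w n b, K w (n ⊗ₜ b) = n ⊗ₜ (b * w) :=
      ⟨TensorProduct.mapBilinear (.id k) M A M A LinearMap.id ∘ₗ (LinearMap.mul k A).flip,
        fun _ _ _ => by simp⟩
    have hY : ∀ b, ∑ j ∈ (ℛ k b).index, K ((ℛ k b).left j) (ρ (ω ((ℛ k b).right j ⊗ₜ m))) =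
        hopfRHS k A ω ρ (b ⊗ₜ m) := fun b => by
      rw [← hM]
      simp only [ydLHS, LinearMap.comp_apply, TensorProduct.map_tmul, ΔA, ← (ℛ k b).eq,
        TensorProduct.sum_tmul, map_sum, LinearMap.id_apply, LinearEquiv.coe_coe,
        TensorProduct.assoc_tmul, TensorProduct.comm_tmul]
      refine Finset.sum_congr rfl fun j _ => ?_
      generalize ρ _ = t
      induction t <;> simp_all [TensorProduct.add_tmul]
    have hR : ∀ b t, rdiagStep r ((TensorProduct.map f (μA k A))
        ((TensorProduct.tensorTensorTensorComm k P A M A) ((y ⊗ₜ u) ⊗ₜ t)) ⊗ₜ b) =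
        ∑ j ∈ (ℛ k b).index, G ((ℛ k b).left j) (K ((ℛ k b).right j) t) := fun b t => by
      induction t with
      | zero => simp
      | add _ _ h h' =>
        simp only [TensorProduct.tmul_add, TensorProduct.add_tmul, map_add,
          Finset.sum_add_distrib, h, h']
      | tmul n v => simp [rdiagStep_tmul, hG, hK, mul_assoc]
    simp only [LinearEquiv.coe_coe, hR]
    rw [sum_coassoc a (fun v w z => G v (K w (ρ (ω (z ⊗ₜ m)))))]
    · simp only [← map_sum, hY]
      simp only [hopfRHS, LinearMap.comp_apply, TensorProduct.map_tmul]
      generalize ρ m = t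
      induction t with
      | zero => simp
      | add _ _ h h' =>
        simp only [TensorProduct.tmul_add, map_add, Finset.sum_add_distrib, h, h']
      | tmul n v =>
        have h := sum_coassoc (k := k) a
          (fun b c z => r (f (y ⊗ₜ ω (c ⊗ₜ n)) ⊗ₜ b) ⊗ₜ[k] (u * (z * v)))
        simp only [ΔA, ← (ℛ k _).eq, TensorProduct.sum_tmul, map_sum, LinearEquiv.coe_coe,
          TensorProduct.tensorTensorTensorComm_tmul, TensorProduct.map_tmul, hG,
          LinearMap.mul'_apply]
        rw [← h]
        · simp [TensorProduct.tmul_sum, TensorProduct.sum_tmul, lastFace_tmul, mul_assoc]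
        all_goals
          intros
          constructor <;> intros <;>
            simp [TensorProduct.add_tmul, TensorProduct.tmul_add, mul_add, add_mul,
              ← TensorProduct.smul_tmul']
    all_goals
      intros
      constructor <;> intros <;> simp [TensorProduct.add_tmul, ← TensorProduct.smul_tmul']

/-- The map `n ⊗ b ↦ Σ n₀ ⊗ n₁ b`. -/
def baseTwist (ρ : N →ₗ[k] N ⊗[k] A) : N ⊗[k] A →ₗ[k] N ⊗[k] A :=
  ((TensorProduct.map (LinearMap.id : N →ₗ[k] N) (μA k A)).comp
    (TensorProduct.assoc k N A A).toLinearMap).comp (TensorProduct.map ρ LinearMap.id)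

/-- The map `n ⊗ a ↦ ε(a) n`. -/
def counitAct (N : Type) [AddCommGroup N] [Module k N] : N ⊗[k] A →ₗ[k] N :=
  (TensorProduct.rid k N).toLinearMap.comp
    (TensorProduct.map (LinearMap.id : N →ₗ[k] N) (εA k A))

lemma baseTwist_tmul (ρ : N →ₗ[k] N ⊗[k] A) (n : N) (b : A) :
    baseTwist ρ (n ⊗ₜ b) =
      TensorProduct.map (LinearMap.id : N →ₗ[k] N) (LinearMap.mulRight k b) (ρ n) := by
  simp only [baseTwist, LinearMap.comp_apply, TensorProduct.map_tmul, LinearMap.id_apply]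
  generalize ρ n = t
  induction t <;> simp_all [TensorProduct.add_tmul]

lemma ldiagStep_baseTwist {ω : A ⊗[k] N →ₗ[k] N} {ρ : N →ₗ[k] N ⊗[k] A}
    (h : ydLHS k A ω ρ = hopfRHS k A ω ρ) (a : A) (y : N) (b : A) :
    ∑ i ∈ (ℛ k a).index,
        baseTwist ρ (ω ((ℛ k a).right i ⊗ₜ y) ⊗ₜ ((ℛ k a).left i * b)) =
      ldiagStep ω (a ⊗ₜ baseTwist ρ (y ⊗ₜ b)) := by
  have h' := congrArg (TensorProduct.map (LinearMap.id : N →ₗ[k] N) (LinearMap.mulRight k b))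
    (LinearMap.congr_fun h (a ⊗ₜ y))
  simp only [baseTwist_tmul]
  convert h' using 1
  · simp only [ydLHS, LinearMap.comp_apply, TensorProduct.map_tmul, ΔA, ← (ℛ k a).eq,
      TensorProduct.sum_tmul, map_sum, LinearMap.id_apply, LinearEquiv.coe_coe,
      TensorProduct.assoc_tmul, TensorProduct.comm_tmul]
    refine Finset.sum_congr rfl fun j _ => ?_
    generalize ρ _ = t
    induction t <;> simp_all [TensorProduct.add_tmul, mul_assoc]
  · simp only [hopfRHS, LinearMap.comp_apply, TensorProduct.map_tmul]
    generalize ρ y = t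
    induction t with
    | zero => simp
    | add _ _ h h' => simp only [TensorProduct.tmul_add, map_add, h, h']
    | tmul n v =>
      simp [ldiagStep_tmul, ΔA, ← (ℛ k a).eq, TensorProduct.sum_tmul, mul_assoc]

lemma rdiagStep_baseTwist (ρ : N →ₗ[k] N ⊗[k] A) (y : N) (a b : A) :
    ∑ i ∈ (ℛ k a).index,
        baseTwist ρ (counitAct N (y ⊗ₜ[k] (ℛ k a).right i) ⊗ₜ (b * (ℛ k a).left i)) =
      rdiagStep (counitAct N) (baseTwist ρ (y ⊗ₜ b) ⊗ₜ a) := by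
  have h := sum_counit_right (k := k) a (fun v => baseTwist ρ (y ⊗ₜ[k] (b * v)))
    (by constructor <;> intros <;> simp [mul_add, TensorProduct.tmul_add])
  have h' : ∀ t : N ⊗[k] A, rdiagStep (counitAct N) (t ⊗ₜ a) =
      TensorProduct.map (LinearMap.id : N →ₗ[k] N) (LinearMap.mulRight k a) t := by
    intro t
    induction t with
    | zero => simp
    | add _ _ h h' => simp only [TensorProduct.add_tmul, map_add, h, h']
    | tmul n v =>
      have h'' := sum_counit_left (k := k) a (fun w => n ⊗ₜ[k] (v * w))
        (by constructor <;> intros <;> simp [mul_add, TensorProduct.tmul_add])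
      simpa [rdiagStep_tmul, counitAct, TensorProduct.smul_tmul'] using h''
  rw [h']
  simp only [counitAct, LinearMap.comp_apply, TensorProduct.map_tmul, LinearEquiv.coe_coe,
    TensorProduct.rid_tmul, LinearMap.id_apply, ← TensorProduct.smul_tmul', map_smul]
  rw [h, baseTwist_tmul, baseTwist_tmul]
  generalize ρ y = t
  induction t <;> simp_all [mul_assoc]

lemma dLStep_comm (a : A) (c : k) :
    dLStep ((TensorProduct.map (Algebra.linearMap k A) (LinearMap.id : k →ₗ[k] k)).comp
        (TensorProduct.lid k k).symm.toLinearMap) (TensorProduct.comm k A k (a ⊗ₜ c)) =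
      dLIns (TensorProduct.comm k A k).toLinearMap
        (ΔA k A a ⊗ₜ (TensorProduct.map (Algebra.linearMap k A) (LinearMap.id : k →ₗ[k] k)).comp
          (TensorProduct.lid k k).symm.toLinearMap c) := by
  simp [dLStep, dLIns, ΔA, ← (ℛ k a).eq, TensorProduct.tmul_sum, TensorProduct.sum_tmul]

lemma dRStep_comm (a : A) (c : k) :
    dRStep ((TensorProduct.map (LinearMap.id : k →ₗ[k] k) (Algebra.linearMap k A)).comp
        (TensorProduct.rid k k).symm.toLinearMap) (TensorProduct.comm k A k (a ⊗ₜ c)) =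
      dRIns (TensorProduct.comm k A k).toLinearMap
        (ΔA k A a ⊗ₜ (TensorProduct.map (LinearMap.id : k →ₗ[k] k) (Algebra.linearMap k A)).comp
          (TensorProduct.rid k k).symm.toLinearMap c) := by
  simp [dRStep, dRIns, ΔA, ← (ℛ k a).eq, TensorProduct.tmul_sum, TensorProduct.sum_tmul]

lemma firstFace_add (ins : A ⊗[k] P ≃ₗ[k] P') (l : A ⊗[k] Y →ₗ[k] Y)
    (f g : P ⊗[k] M →ₗ[k] Y) :
    firstFace ins l (f + g) = firstFace ins l f + firstFace ins l g := by
  simp only [firstFace, TensorProduct.map_add_right, LinearMap.add_comp, LinearMap.comp_add]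

lemma lastFace_add (r : Y ⊗[k] A →ₗ[k] Y) (ω : A ⊗[k] M →ₗ[k] M) (f g : P ⊗[k] M →ₗ[k] Y) :
    lastFace r ω (f + g) = lastFace r ω f + lastFace r ω g := by
  simp only [lastFace, TensorProduct.map_add_right, LinearMap.add_comp, LinearMap.comp_add]

lemma firstCoface_add (d : P →ₗ[k] A ⊗[k] P) (T : Y ⊗[k] A →ₗ[k] Y')
    (f g : P ⊗[k] M →ₗ[k] Y) :
    firstCoface d T (f + g) = firstCoface d T f + firstCoface d T g := by
  simp only [firstCoface, TensorProduct.map_add_right, LinearMap.add_comp, LinearMap.comp_add]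

lemma lastCoface_add (d : P →ₗ[k] P ⊗[k] A) (ρ : M →ₗ[k] M ⊗[k] A)
    (f g : P ⊗[k] M →ₗ[k] Y) :
    lastCoface d ρ (f + g) = lastCoface d ρ f + lastCoface d ρ g := by
  simp only [lastCoface, TensorProduct.map_add_left, LinearMap.add_comp]

end Sweedler

section Faces

open Coalgebra

variable {k A} {M N : Type} [AddCommGroup M] [Module k M] [AddCommGroup N] [Module k N]

lemma ldiag_comulAt (ωN : A ⊗[k] N →ₗ[k] N) (j p : ℕ) (a : A) (y : Cd k A N p) :
    comulAt k A p j (ldiag k A ωN p (a ⊗ₜ y)) =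
      ldiag k A ωN (p + 1) (a ⊗ₜ comulAt k A p j y) := by
  induction p generalizing a with
  | zero => simp [comulAt]
  | succ p ih =>
    by_cases hj : j = p + 1
    · rw [show comulAt k A (p + 1) j = comulLast (Cd k A N p) from if_pos hj]
      exact ldiagStep_comulLast (ldiag k A ωN p) a y
    · rw [show comulAt k A (p + 1) j = TensorProduct.map (comulAt k A p j) LinearMap.id from
        if_neg hj]
      exact ldiagStep_map (ldiag k A ωN p) (ldiag k A ωN (p + 1)) (comulAt k A p j) ih a y

lemma rdiagE_comulAt (j p : ℕ) (y : Cd k A N p) (a : A) :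
    comulAt k A p j (rdiagE k A p (y ⊗ₜ a)) =
      rdiagE k A (p + 1) (comulAt k A p j y ⊗ₜ a) := by
  induction p generalizing a with
  | zero => simp [comulAt]
  | succ p ih =>
    by_cases hj : j = p + 1
    · rw [show comulAt k A (p + 1) j = comulLast (Cd k A N p) from if_pos hj]
      exact rdiagStep_comulLast (rdiagE k A p) y a
    · rw [show comulAt k A (p + 1) j = TensorProduct.map (comulAt k A p j) LinearMap.id from
        if_neg hj]
      exact rdiagStep_map (rdiagE k A p) (rdiagE k A (p + 1)) (comulAt k A p j) ih y a

/-- The map `n ⊗ a¹ ⊗ ⋯ ⊗ aᵖ ⊗ b ↦ Σ n₀ ⊗ n₁ b ⊗ a¹ ⊗ ⋯ ⊗ aᵖ`. -/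
def twist (ρN : N →ₗ[k] N ⊗[k] A) (p : ℕ) : Cd k A N p ⊗[k] A →ₗ[k] Cd k A N (p + 1) :=
  ((shiftB k A p).toLinearMap).comp <|
    (rmulBase k A p).comp (TensorProduct.map (rhoBase k A ρN p) LinearMap.id)

lemma ldiag_twist {ωN : A ⊗[k] N →ₗ[k] N} {ρN : N →ₗ[k] N ⊗[k] A}
    (hN : ydLHS k A ωN ρN = hopfRHS k A ωN ρN) (p : ℕ) (a : A) (y : Cd k A N p) (b : A) :
    ∑ i ∈ (ℛ k a).index,
        twist ρN p (ldiag k A ωN p ((ℛ k a).right i ⊗ₜ y) ⊗ₜ ((ℛ k a).left i * b)) =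
      ldiag k A ωN (p + 1) (a ⊗ₜ twist ρN p (y ⊗ₜ b)) := by
  induction p generalizing a b with
  | zero => exact ldiagStep_baseTwist hN a y b
  | succ p ih =>
    exact ldiagStep_twist (ldiag k A ωN p) (ldiag k A ωN (p + 1)) (twist ρN p) (twist ρN (p + 1))
      (fun _ _ _ => rfl) (fun a y b => ih a y b) a y b

lemma rdiagE_twist (ρN : N →ₗ[k] N ⊗[k] A) (p : ℕ) (y : Cd k A N p) (a b : A) :
    ∑ i ∈ (ℛ k a).index,
        twist ρN p (rdiagE k A p (y ⊗ₜ (ℛ k a).right i) ⊗ₜ (b * (ℛ k a).left i)) =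
      rdiagE k A (p + 1) (twist ρN p (y ⊗ₜ b) ⊗ₜ a) := by
  induction p generalizing a b with
  | zero => exact rdiagStep_baseTwist ρN y a b
  | succ p ih =>
    exact rdiagStep_twist (rdiagE k A p) (rdiagE k A (p + 1)) (twist ρN p) (twist ρN (p + 1))
      (fun _ _ _ => rfl) (fun y a b => ih y a b) y a b

lemma dL_mulP (n i : ℕ) (x : Pk k A (n + 1)) :
    dL k A n (mulP k A n i x) =
      TensorProduct.map LinearMap.id (mulP k A n i) (dL k A (n + 1) x) := by
  induction n with
  | zero => simp [mulP]
  | succ n ih =>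
    by_cases hi : i = n + 1
    · rw [show mulP k A (n + 1) i = mulLast (Pk k A n) from if_pos hi]
      exact dLStep_mulLast (dL k A n) x
    · rw [show mulP k A (n + 1) i = TensorProduct.map (mulP k A n i) LinearMap.id from
        if_neg hi]
      exact dLStep_map (dL k A (n + 1)) (dL k A n) (mulP k A n i) ih x

lemma dR_mulP (n i : ℕ) (x : Pk k A (n + 1)) :
    dR k A n (mulP k A n i x) =
      TensorProduct.map (mulP k A n i) LinearMap.id (dR k A (n + 1) x) := by
  induction n with
  | zero => simp [mulP]
  | succ n ih =>
    by_cases hi : i = n + 1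
    · rw [show mulP k A (n + 1) i = mulLast (Pk k A n) from if_pos hi]
      exact dRStep_mulLast (dR k A n) x
    · rw [show mulP k A (n + 1) i = TensorProduct.map (mulP k A n i) LinearMap.id from
        if_neg hi]
      exact dRStep_map (dR k A (n + 1)) (dR k A n) (mulP k A n i) ih x

lemma dL_insP (n : ℕ) (a : A) (x : Pk k A n) :
    dL k A (n + 1) (insP k A n (a ⊗ₜ x)) =
      dLIns (insP k A n).toLinearMap (ΔA k A a ⊗ₜ dL k A n x) := by
  induction n generalizing a with
  | zero => exact dLStep_comm (k := k) a x
  | succ n ih =>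
    exact dLStep_ins (insP k A n).toLinearMap (insP k A (n + 1)).toLinearMap
      (fun _ _ _ => rfl) (dL k A n) (dL k A (n + 1)) ih a x

lemma dR_insP (n : ℕ) (a : A) (x : Pk k A n) :
    dR k A (n + 1) (insP k A n (a ⊗ₜ x)) =
      dRIns (insP k A n).toLinearMap (ΔA k A a ⊗ₜ dR k A n x) := by
  induction n generalizing a with
  | zero => exact dRStep_comm (k := k) a x
  | succ n ih =>
    exact dRStep_ins (insP k A n).toLinearMap (insP k A (n + 1)).toLinearMap
      (fun _ _ _ => rfl) (dR k A n) (dR k A (n + 1)) ih a x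

lemma cof0YD_eq (ρN : N →ₗ[k] N ⊗[k] A) (n p : ℕ) (f : Yc k A M N n p) :
    cof0YD k A ρN n p f = firstCoface (dL k A n) (twist ρN p) f := by
  refine TensorProduct.ext' fun x m => ?_
  simp only [cof0YD, firstCoface, twist, LinearMap.comp_apply, TensorProduct.map_tmul]
  generalize dL k A n x = s
  induction s with
  | zero => simp
  | add _ _ h h' => simp only [TensorProduct.add_tmul, map_add, h, h']
  | tmul u y => simp

variable {ωM : A ⊗[k] M →ₗ[k] M} {ρM : M →ₗ[k] M ⊗[k] A}
  {ωN : A ⊗[k] N →ₗ[k] N} {ρN : N →ₗ[k] N ⊗[k] A}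

lemma cYD_face0 (hN : ydLHS k A ωN ρN = hopfRHS k A ωN ρN) (n p j : ℕ) (f : Yc k A M N n p) :
    cYD k A ρM ρN (n + 1) p j (face0 k A ωN n p f) =
      face0 k A ωN n (p + 1) (cYD k A ρM ρN n p j f) := by
  unfold cYD
  split_ifs
  · rw [cof0YD_eq, cof0YD_eq]
    exact firstCoface_firstFace (insP k A n) (dL k A n) (dL k A (n + 1)) (dL_insP n)
      (ldiag k A ωN p) (ldiag k A ωN (p + 1)) (twist ρN p) (ldiag_twist hN p) f
  · exact firstFace_comp (insP k A n) (ldiag k A ωN p) (ldiag k A ωN (p + 1))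
      (comulAt k A p j) (ldiag_comulAt ωN j p) f
  · exact lastCoface_firstFace (insP k A n) (dR k A n) (dR k A (n + 1)) (dR_insP n)
      (ldiag k A ωN p) ρM f

lemma cYD_faceMid (n p i j : ℕ) (f : Yc k A M N n p) :
    cYD k A ρM ρN (n + 1) p j (faceMid k A n p i f) =
      faceMid k A n (p + 1) i (cYD k A ρM ρN n p j f) := by
  unfold cYD
  split_ifs
  · rw [cof0YD_eq, cof0YD_eq]
    exact firstCoface_comp (dL k A n) (dL k A (n + 1)) (mulP k A n i) (dL_mulP n i)
      (twist ρN p) f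
  · rfl
  · exact lastCoface_comp (dR k A n) (dR k A (n + 1)) (mulP k A n i) (dR_mulP n i) ρM f

lemma cYD_faceLastYD (hM : ydLHS k A ωM ρM = hopfRHS k A ωM ρM) (n p j : ℕ)
    (f : Yc k A M N n p) :
    cYD k A ρM ρN (n + 1) p j (faceLastYD k A ωM n p f) =
      faceLastYD k A ωM n (p + 1) (cYD k A ρM ρN n p j f) := by
  unfold cYD
  split_ifs
  · rw [cof0YD_eq, cof0YD_eq]
    exact firstCoface_lastFace (dL k A n) (rdiagE k A p) (rdiagE k A (p + 1)) (twist ρN p)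
      (rdiagE_twist ρN p) ωM f
  · exact lastFace_comp (rdiagE k A p) (rdiagE k A (p + 1)) ωM (comulAt k A p j)
      (rdiagE_comulAt j p) f
  · exact lastCoface_lastFace (dR k A n) (rdiagE k A p) ωM ρM hM f

lemma cYD_bYD (hM : ydLHS k A ωM ρM = hopfRHS k A ωM ρM)
    (hN : ydLHS k A ωN ρN = hopfRHS k A ωN ρN) (n p i j : ℕ) (f : Yc k A M N n p) :
    cYD k A ρM ρN (n + 1) p j (bYD k A ωM ωN n p i f) =
      bYD k A ωM ωN n (p + 1) i (cYD k A ρM ρN n p j f) := by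
  unfold bYD
  split_ifs
  · exact cYD_face0 hN n p j f
  · exact cYD_faceMid n p i j f
  · exact cYD_faceLastYD hM n p j f

lemma bYD_add (n p i : ℕ) (f g : Yc k A M N n p) :
    bYD k A ωM ωN n p i (f + g) = bYD k A ωM ωN n p i f + bYD k A ωM ωN n p i g := by
  unfold bYD
  split_ifs
  · exact firstFace_add (insP k A n) (ldiag k A ωN p) f g
  · exact LinearMap.add_comp _ _ _
  · exact lastFace_add (rdiagE k A p) ωM f g

lemma cYD_add (n p j : ℕ) (f g : Yc k A M N n p) :
    cYD k A ρM ρN n p j (f + g) = cYD k A ρM ρN n p j f + cYD k A ρM ρN n p j g := by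
  unfold cYD
  split_ifs
  · simp only [cof0YD_eq, firstCoface_add]
  · exact LinearMap.comp_add _ _ _
  · exact lastCoface_add (dR k A n) ρM f g

lemma bYD_sum_zsmul (n p i : ℕ) (s : Finset ℕ) (c : ℕ → ℤ) (f : ℕ → Yc k A M N n p) :
    bYD k A ωM ωN n p i (∑ j ∈ s, c j • f j) = ∑ j ∈ s, c j • bYD k A ωM ωN n p i (f j) := by
  have h := map_sum (AddMonoidHom.mk' (bYD k A ωM ωN n p i) (bYD_add n p i))
    (fun j => c j • f j) s
  simp only [map_zsmul] at h
  exact h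

lemma cYD_sum_zsmul (n p j : ℕ) (s : Finset ℕ) (c : ℕ → ℤ) (f : ℕ → Yc k A M N n p) :
    cYD k A ρM ρN n p j (∑ i ∈ s, c i • f i) = ∑ i ∈ s, c i • cYD k A ρM ρN n p j (f i) := by
  have h := map_sum (AddMonoidHom.mk' (cYD k A ρM ρN n p j) (cYD_add n p j))
    (fun i => c i • f i) s
  simp only [map_zsmul] at h
  exact h

end Faces

/-- The horizontal face maps commute with the vertical coface maps,
`c_j^{n+1,p} ∘ b_i^{n,p} = b_i^{n,p+1} ∘ c_j^{n,p}` for `0 ≤ i ≤ n+1`, `0 ≤ j ≤ p+1`;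
in particular `d_c^{n+1,p} ∘ d_m^{n,p} = d_m^{n,p+1} ∘ d_c^{n,p}`, so
`(Y^{n,p}(M,N), d_m, d_c)` is a double complex. -/
theorem cYD_bYD_comm (k : Type) [Field k] (A : Type) [Ring A] [Bialgebra k A]
    (M N : Type) [AddCommGroup M] [Module k M] [AddCommGroup N] [Module k N]
    (ωM : A ⊗[k] M →ₗ[k] M) (ρM : M →ₗ[k] M ⊗[k] A)
    (ωN : A ⊗[k] N →ₗ[k] N) (ρN : N →ₗ[k] N ⊗[k] A)
    (hM : IsYetterDrinfeld k A ωM ρM) (hN : IsYetterDrinfeld k A ωN ρN) :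
    (∀ (n p i j : ℕ), i ≤ n + 1 → j ≤ p + 1 → ∀ f : Yc k A M N n p,
      cYD k A ρM ρN (n+1) p j (bYD k A ωM ωN n p i f) =
        bYD k A ωM ωN n (p+1) i (cYD k A ρM ρN n p j f)) ∧
    (∀ (n p : ℕ) (f : Yc k A M N n p),
      dcYD k A ρM ρN (n+1) p (dmYD k A ωM ωN n p f) =
        dmYD k A ωM ωN n (p+1) (dcYD k A ρM ρN n p f)) := by
  have hcomm := fun n p i j (f : Yc k A M N n p) =>
    cYD_bYD hM.2.2 hN.2.2 n p i j f
  refine ⟨fun n p i j _ _ f => hcomm n p i j f, fun n p f => ?_⟩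
  unfold dcYD dmYD
  simp only [cYD_sum_zsmul, bYD_sum_zsmul, hcomm, Finset.smul_sum]
  rw [Finset.sum_comm]
  exact Finset.sum_congr rfl fun _ _ => Finset.sum_congr rfl fun _ _ => smul_comm _ _ _

end PS
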